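/- A C∞-word w is right maximal if and only if there exists a letter x ∈ Σ such that wx is a right minimal C∞-word; moreover, if wx is a right minimal C∞-word for some x ∈ Σ, then w x̄ is also a right minimal C∞-word. Symmetrically, w is left maximal if and only if there exists x ∈ Σ such that xw is a left minimal C∞-word, and if xw is a left minimal C∞-word then so is x̄w. -/

import Mathlib

/- Common framework: words over the alphabet Σ = {1,2} (represented as natural
numbers), run-length encoding, the derivative D, k-differentiable words C^k,
C∞-words, heights, roots, primitives, minimal/maximal words, simple extensions,
minimal forbidden words, and the left frontier Ψ. -/

namespace CinftyWords

/-- A word is a finite sequence of natural numbers. -/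
abbrev Word := List ℕ

/-- `w` is a word over the alphabet Σ = {1,2}. -/
def IsWord (w : Word) : Prop := ∀ x ∈ w, x = 1 ∨ x = 2

/-- Complement of a letter: exchanges 1 and 2. -/
def bar (x : ℕ) : ℕ := 3 - x

/-- Letterwise complement of a word. -/
def comp (w : Word) : Word := w.map bar

/-- Run-length encoding Δ: the sequence of lengths of maximal runs of equal
consecutive letters. -/
def rle (w : Word) : Word := (w.splitBy (· == ·)).map List.length

/-- Drop the first run if it has length 1. -/
def dropFirstRun1 (g : List (List ℕ)) : List (List ℕ) :=
  match g with
  | [] => []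
  | r :: rs => if r.length = 1 then rs else r :: rs

/-- The derivative `D w`: the run-length encoding of the word obtained from `w`
by deleting its first and/or last run when that run has length 1. -/
def D (w : Word) : Word :=
  ((dropFirstRun1 ((dropFirstRun1 (w.splitBy (· == ·))).reverse)).reverse).map List.length

/-- `w` is differentiable: `w` is a word over Σ and so is its run-length encoding. -/
def Diffble (w : Word) : Prop := IsWord w ∧ IsWord (rle w)

/-- The set C^k of k-differentiable words: `D^[j] w` is differentiable for all `j < k`
(so that `D^[k] w` is defined). -/
def CK (k : ℕ) : Set Word := {w | IsWord w ∧ ∀ j < k, Diffble (D^[j] w)}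

/-- The set C∞ of words differentiable arbitrarily many times. -/
def Cinf : Set Word := {w | ∀ k : ℕ, w ∈ CK k}

/-- The height of a C∞-word: the least `k` with `D^[k] w = []`. -/
noncomputable def height (w : Word) : ℕ := sInf {k | D^[k] w = []}

/-- The root of a C∞-word: `D^[height w - 1] w`. -/
noncomputable def root (w : Word) : Word := D^[height w - 1] w

/-- `v` is a primitive of `w`: `v` is differentiable and `D v = w`. -/
def IsPrimitive (v w : Word) : Prop := Diffble v ∧ D v = w

/-- A nonempty C∞-word is maximal if each `D^[j] w` (for `j ≤ height w - 2`) is a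
primitive of `D^[j+1] w` of maximal length (vacuously true when `height w = 1`). -/
def MaximalWord (w : Word) : Prop :=
  w ∈ Cinf ∧ w ≠ [] ∧ ∀ j, j + 2 ≤ height w →
    ∀ v, IsPrimitive v (D^[j + 1] w) → v.length ≤ (D^[j] w).length

/-- A nonempty C∞-word is minimal if each `D^[j] w` (for `j ≤ height w - 2`) is a
primitive of `D^[j+1] w` of minimal length (vacuously true when `height w = 1`). -/
def MinimalWord (w : Word) : Prop :=
  w ∈ Cinf ∧ w ≠ [] ∧ ∀ j, j + 2 ≤ height w →
    ∀ v, IsPrimitive v (D^[j + 1] w) → (D^[j] w).length ≤ v.length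

/-- `w` is right maximal: a suffix of a maximal word. -/
def RightMaximal (w : Word) : Prop := ∃ v, MaximalWord v ∧ w <:+ v

/-- `w` is left maximal: a prefix of a maximal word. -/
def LeftMaximal (w : Word) : Prop := ∃ v, MaximalWord v ∧ w <+: v

/-- `w` is right minimal: a suffix of a minimal word. -/
def RightMinimal (w : Word) : Prop := ∃ v, MinimalWord v ∧ w <:+ v

/-- `w` is left minimal: a prefix of a minimal word. -/
def LeftMinimal (w : Word) : Prop := ∃ v, MinimalWord v ∧ w <+: v

/-- `w` is right doubly extendable: both `w1` and `w2` are C∞-words. -/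
def RightDoublyExt (w : Word) : Prop := w ++ [1] ∈ Cinf ∧ w ++ [2] ∈ Cinf

/-- `w` is left doubly extendable: both `1w` and `2w` are C∞-words. -/
def LeftDoublyExt (w : Word) : Prop := 1 :: w ∈ Cinf ∧ 2 :: w ∈ Cinf

/-- `w` is fully extendable: `1w1`, `1w2`, `2w1`, `2w2` are all C∞-words. -/
def FullyExt (w : Word) : Prop :=
  ∀ x, (x = 1 ∨ x = 2) → ∀ y, (y = 1 ∨ y = 2) → x :: (w ++ [y]) ∈ Cinf

/-- `w'` is a right simple extension of `w`: `w' = w ++ s` is a C∞-word and at each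
step the extension by the complementary letter is not a C∞-word. -/
def RightSimpleExt (w w' : Word) : Prop :=
  w' ∈ Cinf ∧ ∃ s : Word, IsWord s ∧ w' = w ++ s ∧
    ∀ i < s.length, w ++ s.take i ++ [bar (s.getD i 0)] ∉ Cinf

/-- `w'` is a left simple extension of `w`. -/
def LeftSimpleExt (w w' : Word) : Prop := RightSimpleExt w.reverse w'.reverse

/-- `w'` is a simple extension of `w`: a right simple extension of a left simple
extension of `w`. -/
def SimpleExt (w w' : Word) : Prop := ∃ v, LeftSimpleExt w v ∧ RightSimpleExt v w'

/-- `m` is the maximal extension of `w`: a simple extension of `w` of maximal length. -/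
def IsMaximalExtension (w m : Word) : Prop :=
  SimpleExt w m ∧ ∀ v, SimpleExt w v → v.length ≤ m.length

/-- A language is factorial if it is closed under taking factors. -/
def Factorial (F : Set Word) : Prop := ∀ v ∈ F, ∀ u, u <:+: v → u ∈ F

/-- A language is anti-factorial if no word of it is a proper factor of another
word of it. -/
def AntiFactorial (M : Set Word) : Prop := ∀ u ∈ M, ∀ v ∈ M, u ≠ v → ¬ u <:+: v

/-- The set of minimal forbidden words of a (factorial) language `F`: words not
in `F` whose maximal proper prefix and maximal proper suffix are both in `F`. -/
def MF (F : Set Word) : Set Word := {v | v ∉ F ∧ v.dropLast ∈ F ∧ v.tail ∈ F}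

/-- The height of a minimal forbidden word of C∞: `k + 1`, where `k` is the
(unique) integer such that `w` is k-differentiable and `D^[k] w ∈ {111, 222}`. -/
noncomputable def MFheight (w : Word) : ℕ :=
  sInf {k | w ∈ CK k ∧ (D^[k] w = [1, 1, 1] ∨ D^[k] w = [2, 2, 2])} + 1

/-- The left frontier Ψ of a C∞-word: the word of length `height w` over {0,1,2}
recording the first letter of each derivative, with `2` replaced by `0` when the
first two letters of the previous derivative are distinct. -/
noncomputable def psi (w : Word) : List ℕ :=
  (List.range (height w)).map (fun i =>
    if i = 0 then w.getD 0 0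
    else if (D^[i] w).getD 0 0 = 2 ∧ (D^[i - 1] w).getD 0 0 ≠ (D^[i - 1] w).getD 1 0 then 0
    else (D^[i] w).getD 0 0)

theorem bar_eq {x : ℕ} (hx : x = 1 ∨ x = 2) : bar x = 1 ∨ bar x = 2 := by
  unfold bar; omega

theorem bar_ne (x : ℕ) : bar x ≠ x := by
  unfold bar; omega

theorem isWord_cons {x : ℕ} {w : Word} : IsWord (x :: w) ↔ (x = 1 ∨ x = 2) ∧ IsWord w := by
  simp [IsWord]

theorem isWord_append {u w : Word} : IsWord (u ++ w) ↔ IsWord u ∧ IsWord w := by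
  simp only [IsWord, List.mem_append]
  exact ⟨fun h => ⟨fun x hx => h x (.inl hx), fun x hx => h x (.inr hx)⟩,
    fun h x hx => hx.elim (h.1 x) (h.2 x)⟩

theorem isWord_reverse {w : Word} : IsWord w.reverse ↔ IsWord w := by
  simp [IsWord]

/-! ### Run-length encoding -/

theorem rle_nil : rle [] = [] := rfl

theorem rle_singleton (x : ℕ) : rle [x] = [1] := rfl

theorem rle_cons_cons_of_ne {x y : ℕ} (h : x ≠ y) (w : Word) :
    rle (x :: y :: w) = 1 :: rle (y :: w) := by
  have := List.splitBy_append_cons (r := (· == ·)) (l := [x]) (a := y) w (by simpa using h)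
  simp only [List.singleton_append] at this
  rw [rle, this]
  rfl

theorem rle_cons_cons_self (x : ℕ) (w : Word) :
    ∃ n t, rle (x :: w) = n :: t ∧ rle (x :: x :: w) = (n + 1) :: t := by
  obtain ⟨h1, h2, h3, h4⟩ := List.splitBy_eq_iff.1 (rfl : (x :: w).splitBy (· == ·) = _)
  rcases hs : (x :: w).splitBy (· == ·) with _ | ⟨g, gs⟩
  · simp at hs
  rw [hs] at h1 h2 h3 h4
  rcases g with _ | ⟨y, g⟩
  · simp at h2
  obtain ⟨rfl, hw⟩ : x = y ∧ w = g ++ gs.flatten := by simpa using h1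
  have : (x :: x :: w).splitBy (· == ·) = (x :: x :: g) :: gs := by
    refine List.splitBy_eq_iff.2 ⟨by simp [hw], by simpa using h2, ?_, ?_⟩
    · intro m hm
      rcases List.mem_cons.1 hm with rfl | hm
      · have := h3 (x :: g) (by simp)
        simpa using this
      · exact h3 m (by simp [hm])
    · rcases gs with _ | ⟨k, gs⟩
      · simp
      · simp only [List.isChain_cons_cons] at h4 ⊢
        simp_all
  exact ⟨(x :: g).length, gs.map List.length, by simp [rle, hs], by simp [rle, this]⟩

theorem rle_reverse (w : Word) : rle w.reverse = (rle w).reverse := by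
  obtain ⟨h1, h2, h3, h4⟩ := List.splitBy_eq_iff.1 (rfl : w.splitBy (· == ·) = _)
  have : w.reverse.splitBy (· == ·) = ((w.splitBy (· == ·)).map List.reverse).reverse := by
    refine List.splitBy_eq_iff.2 ⟨?_, by simp, ?_, ?_⟩
    · conv_lhs => rw [h1]
      exact List.reverse_flatten
    · intro m hm
      obtain ⟨k, hk, rfl⟩ : ∃ k ∈ w.splitBy (· == ·), k.reverse = m := by simpa using hm
      rw [List.isChain_reverse]
      refine (h3 k hk).imp fun a b hab => ?_
      exact beq_iff_eq.2 (beq_iff_eq.1 hab).symm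
    · rw [List.isChain_reverse, List.isChain_map]
      refine h4.imp fun a b hab => ?_
      obtain ⟨ha, hb, hab⟩ := hab
      refine ⟨by simpa using hb, by simpa using ha, ?_⟩
      simp only [List.getLast_reverse, List.head_reverse]
      exact beq_eq_false_iff_ne.2 (beq_eq_false_iff_ne.1 hab).symm
  rw [rle, this, rle, List.map_reverse, List.map_map]
  congr 2
  funext l
  simp

theorem sum_rle (w : Word) : (rle w).sum = w.length := by
  rw [rle, ← List.length_flatten, List.flatten_splitBy]

theorem pos_of_mem_rle {w : Word} {n : ℕ} (h : n ∈ rle w) : 0 < n := by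
  obtain ⟨l, hl, rfl⟩ := List.mem_map.1 h
  exact List.length_pos_iff.2 (List.ne_nil_of_mem_splitBy hl)

theorem rle_eq_nil {w : Word} : rle w = [] ↔ w = [] := by
  simp [rle]

/-- The word with first letter `x` and run-length encoding `l`. -/
def decode (x : ℕ) : List ℕ → Word
  | [] => []
  | n :: l => List.replicate n x ++ decode (bar x) l

theorem isWord_decode {x : ℕ} (hx : x = 1 ∨ x = 2) (l : List ℕ) : IsWord (decode x l) := by
  induction l generalizing x with
  | nil => simp [decode, IsWord]
  | cons n l ih =>
    refine isWord_append.2 ⟨fun y hy => ?_, ih (bar_eq hx)⟩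
    rwa [List.eq_of_mem_replicate hy]

theorem rle_decode {x : ℕ} (hx : x = 1 ∨ x = 2) {l : List ℕ} (hl : ∀ n ∈ l, 0 < n) :
    rle (decode x l) = l := by
  induction l generalizing x with
  | nil => rfl
  | cons n l ih =>
    have ih := ih (bar_eq hx) fun m hm => hl m (by simp [hm])
    obtain ⟨n, rfl⟩ := Nat.exists_eq_succ_of_ne_zero (hl n (by simp)).ne'
    clear hl
    rw [decode]
    induction n with
    | zero =>
      rcases l with _ | ⟨m, l⟩
      · rfl
      · rcases hd : decode (bar x) (m :: l) with _ | ⟨y, v⟩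
        · simp [hd, rle_nil] at ih
        · have hy : y = bar x := by
            rcases m with _ | m
            · have := pos_of_mem_rle (w := decode (bar x) (0 :: l)) (n := 0) (by simp [ih])
              omega
            · simp [decode, List.replicate_succ] at hd
              exact hd.1.symm
          rw [hd] at ih
          rw [show List.replicate (Nat.succ 0) x ++ y :: v = x :: y :: v from rfl,
            rle_cons_cons_of_ne (by rw [hy]; exact (bar_ne x).symm), ih]
    | succ n ihn =>
      obtain ⟨a, t, h1, h2⟩ := rle_cons_cons_self x (List.replicate n x ++ decode (bar x) l)
      rw [show List.replicate n.succ x ++ decode (bar x) l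
        = x :: (List.replicate n x ++ decode (bar x) l) from rfl, h1] at ihn
      simp only [List.replicate_succ, List.cons_append]
      rw [h2]
      simp_all

theorem decode_rle {x : ℕ} {w : Word} (hw : IsWord (x :: w)) :
    decode x (rle (x :: w)) = x :: w := by
  induction w generalizing x with
  | nil => rfl
  | cons y w ih =>
    obtain ⟨hx, hw⟩ := isWord_cons.1 hw
    obtain ⟨hy, -⟩ := isWord_cons.1 hw
    by_cases hxy : x = y
    · subst hxy
      obtain ⟨n, t, h1, h2⟩ := rle_cons_cons_self x w
      have := ih hw
      rw [h1] at this
      rw [h2, ← this]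
      rfl
    · have : y = bar x := by unfold bar; omega
      rw [rle_cons_cons_of_ne hxy, decode, ← this, ih hw]
      rfl

theorem decode_append {x : ℕ} (hx : x = 1 ∨ x = 2) (l : List ℕ) :
    ∃ y, (y = 1 ∨ y = 2) ∧ ∀ m, decode x (l ++ m) = decode x l ++ decode y m := by
  induction l generalizing x with
  | nil => exact ⟨x, hx, fun m => rfl⟩
  | cons n l ih =>
    obtain ⟨y, hy, h⟩ := ih (bar_eq hx)
    exact ⟨y, hy, fun m => by simp [decode, h]⟩

theorem decode_prefix {x : ℕ} (hx : x = 1 ∨ x = 2) (l : List ℕ) {q m : List ℕ}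
    (hq : q = [1] ∨ q = []) (hm : m ≠ []) (hpos : ∀ n ∈ m, 0 < n) :
    decode x (l ++ q) <+: decode x (l ++ m) := by
  obtain ⟨y, -, h⟩ := decode_append hx l
  rw [h, h, List.prefix_append_right_inj]
  rcases hq with rfl | rfl
  · rcases m with _ | ⟨n, m⟩
    · exact absurd rfl hm
    · obtain ⟨n, rfl⟩ := Nat.exists_eq_succ_of_ne_zero (hpos n (by simp)).ne'
      simp [decode, List.replicate_succ]
  · exact List.nil_prefix

theorem rle_cons (x : ℕ) (w : Word) :
    rle (x :: w) = 1 :: rle w ∨ ∃ n t, rle w = n :: t ∧ rle (x :: w) = (n + 1) :: t := by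
  rcases w with _ | ⟨y, w⟩
  · exact .inl rfl
  · by_cases hxy : x = y
    · subst hxy
      exact .inr (rle_cons_cons_self x w)
    · exact .inl (rle_cons_cons_of_ne hxy w)

theorem rle_of_suffix {u w : Word} (h : u <:+ w) :
    rle u <:+ rle w ∨ ∃ l m n t, rle u = m :: l ∧ rle w = t ++ n :: l ∧ m < n := by
  induction w with
  | nil =>
    rw [List.suffix_nil.1 h]
    exact .inl List.suffix_rfl
  | cons x w ih =>
    rcases List.suffix_cons_iff.1 h with rfl | h
    · exact .inl List.suffix_rfl
    rcases rle_cons x w with hw | ⟨k, s, hw, hxw⟩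
    · rw [hw]
      rcases ih h with ih | ⟨l, m, n, t, h1, h2, h3⟩
      · exact .inl (ih.trans (List.suffix_cons _ _))
      · exact .inr ⟨l, m, n, 1 :: t, h1, by simp [h2], h3⟩
    · rw [hxw]
      rw [hw] at ih
      rcases ih h with ih | ⟨l, m, n, t, h1, h2, h3⟩
      · rcases List.suffix_cons_iff.1 ih with ih | ih
        · exact .inr ⟨s, k, k + 1, [], ih, rfl, by omega⟩
        · exact .inl (ih.trans (List.suffix_cons _ _))
      · rcases t with _ | ⟨a, t⟩
        · obtain ⟨rfl, rfl⟩ := List.cons.inj h2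
          exact .inr ⟨s, m, k + 1, [], h1, rfl, by omega⟩
        · obtain ⟨rfl, rfl⟩ := List.cons.inj h2
          exact .inr ⟨l, m, n, (k + 1) :: t, h1, rfl, h3⟩

theorem rle_of_prefix {u w : Word} (hw : IsWord (rle w)) (h : u <+: w) :
    rle u <+: rle w ∨ ∃ l t, rle u = l ++ [1] ∧ rle w = l ++ 2 :: t := by
  rcases rle_of_suffix (List.reverse_suffix.2 h) with h | ⟨l, m, n, t, h1, h2, h3⟩
  · rw [rle_reverse, rle_reverse, List.reverse_suffix] at h
    exact .inl h
  · rw [rle_reverse, List.reverse_eq_iff] at h1 h2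
    have hm : 0 < m := pos_of_mem_rle (w := u) (by simp [h1])
    have hn := hw n (by simp [h2])
    obtain ⟨rfl, rfl⟩ : m = 1 ∧ n = 2 := by omega
    exact .inr ⟨l.reverse, t.reverse, by simpa using h1, by simpa using h2⟩

/-! ### The derivative in terms of the run-length encoding -/

/-- Remove the first entry if it is equal to `1`. -/
def drop1 (l : List ℕ) : List ℕ := if l.head? = some 1 then l.tail else l

/-- Remove the last entry if it is equal to `1`. -/
def drop1Right (l : List ℕ) : List ℕ := (drop1 l.reverse).reverse

theorem map_length_dropFirstRun1 (g : List (List ℕ)) :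
    (dropFirstRun1 g).map List.length = drop1 (g.map List.length) := by
  rcases g with _ | ⟨r, rs⟩
  · rfl
  · by_cases h : r.length = 1 <;> simp [dropFirstRun1, drop1, h]

theorem D_eq (w : Word) : D w = drop1Right (drop1 (rle w)) := by
  simp only [D, drop1Right, rle, List.map_reverse, map_length_dropFirstRun1]

theorem drop1_one_cons (l : List ℕ) : drop1 (1 :: l) = l := by simp [drop1]

theorem drop1_of_head?_ne {l : List ℕ} (h : l.head? ≠ some 1) : drop1 l = l := by
  simp [drop1, h]

theorem drop1_append {l : List ℕ} (hl : l ≠ []) (m : List ℕ) :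
    drop1 (l ++ m) = drop1 l ++ m := by
  rcases l with _ | ⟨a, l⟩
  · exact absurd rfl hl
  · by_cases h : a = 1 <;> simp [drop1, h]

theorem drop1Right_append {l : List ℕ} (hl : l ≠ []) (m : List ℕ) :
    drop1Right (m ++ l) = m ++ drop1Right l := by
  simp [drop1Right, drop1_append (List.reverse_eq_nil_iff.not.2 hl)]

theorem drop1Right_cons {l : List ℕ} (hl : l ≠ []) (a : ℕ) :
    drop1Right (a :: l) = a :: drop1Right l :=
  drop1Right_append hl [a]

theorem drop1Right_append_one (l : List ℕ) : drop1Right (l ++ [1]) = l := by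
  simp [drop1Right, drop1]

theorem drop1Right_of_getLast?_ne {l : List ℕ} (h : l.getLast? ≠ some 1) :
    drop1Right l = l := by
  rw [drop1Right, drop1_of_head?_ne (by rwa [List.head?_reverse]), List.reverse_reverse]

theorem drop1Right_drop1 (l : List ℕ) : drop1Right (drop1 l) = drop1 (drop1Right l) := by
  rcases l with _ | ⟨a, l⟩
  · rfl
  rcases eq_or_ne l [] with rfl | hl
  · by_cases h : a = 1 <;> simp [drop1, drop1Right, h]
  · rw [drop1Right_cons hl]
    by_cases h : a = 1
    · subst h
      rw [drop1_one_cons, drop1_one_cons]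
    · rw [drop1_of_head?_ne (by simpa using h), drop1_of_head?_ne (by simpa using h),
        drop1Right_cons hl]

theorem D_reverse (w : Word) : D w.reverse = (D w).reverse := by
  rw [D_eq, D_eq, rle_reverse, drop1Right_drop1]
  simp [drop1Right]

theorem exists_drop1 (r : List ℕ) :
    ∃ p, r = p ++ drop1 r ∧ (p = [1] ∨ p = [] ∧ (drop1 r).head? ≠ some 1) := by
  by_cases h : r.head? = some 1
  · obtain ⟨l, rfl⟩ : ∃ l, r = 1 :: l := by
      rcases r with _ | ⟨a, l⟩ <;> simp_all
    exact ⟨[1], by simp [drop1_one_cons], .inl rfl⟩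
  · exact ⟨[], by simp [drop1_of_head?_ne h], .inr ⟨rfl, by rwa [drop1_of_head?_ne h]⟩⟩

theorem exists_drop1Right (r : List ℕ) :
    ∃ q, r = drop1Right r ++ q ∧ (q = [1] ∨ q = [] ∧ (drop1Right r).getLast? ≠ some 1) := by
  obtain ⟨p, h1, h2⟩ := exists_drop1 r.reverse
  refine ⟨p.reverse, ?_, ?_⟩
  · rw [drop1Right, ← List.reverse_append, ← h1, List.reverse_reverse]
  · rwa [drop1Right, List.getLast?_reverse, List.reverse_eq_nil_iff, List.reverse_eq_iff]

theorem rle_eq_of_D_ne_nil {w : Word} (h : D w ≠ []) :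
    ∃ p q, rle w = p ++ D w ++ q ∧ (p = [1] ∨ p = [] ∧ (D w).head? ≠ some 1) ∧
      (q = [1] ∨ q = [] ∧ (D w).getLast? ≠ some 1) := by
  obtain ⟨p, hp, hp'⟩ := exists_drop1 (rle w)
  obtain ⟨q, hq, hq'⟩ := exists_drop1Right (drop1 (rle w))
  rw [← D_eq] at hq hq'
  refine ⟨p, q, by rw [List.append_assoc, ← hq, ← hp], ?_, hq'⟩
  rwa [hq, List.head?_append_of_ne_nil _ h] at hp'

theorem D_eq_of_rle_eq {w : Word} {p u q : List ℕ} (hu : u ≠ []) (hw : rle w = p ++ u ++ q)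
    (hp : p = [1] ∨ p = [] ∧ u.head? ≠ some 1) (hq : q = [1] ∨ q = [] ∧ u.getLast? ≠ some 1) :
    D w = u := by
  have h1 : drop1 (rle w) = u ++ q := by
    rw [hw, List.append_assoc]
    rcases hp with rfl | ⟨rfl, hp⟩
    · exact drop1_one_cons _
    · exact drop1_of_head?_ne (by simpa [List.head?_append_of_ne_nil _ hu] using hp)
  rw [D_eq, h1]
  rcases hq with rfl | ⟨rfl, hq⟩
  · exact drop1Right_append_one u
  · rw [List.append_nil, drop1Right_of_getLast?_ne hq]

theorem drop1Right_prefix (l : List ℕ) : drop1Right l <+: l := by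
  obtain ⟨q, h, -⟩ := exists_drop1Right l
  exact ⟨q, h.symm⟩

theorem drop1Right_prefix_drop1Right {l m : List ℕ} (h : l <+: m) :
    drop1Right l <+: drop1Right m := by
  obtain ⟨t, rfl⟩ := h
  rcases eq_or_ne t [] with rfl | ht
  · simp
  · rw [drop1Right_append ht]
    exact (drop1Right_prefix l).trans (List.prefix_append _ _)

theorem drop1_prefix_drop1 {l m : List ℕ} (h : l <+: m) : drop1 l <+: drop1 m := by
  rcases eq_or_ne l [] with rfl | hl
  · exact List.nil_prefix
  · obtain ⟨t, rfl⟩ := h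
    rw [drop1_append hl]
    exact List.prefix_append _ _

theorem D_prefix {u w : Word} (hw : IsWord (rle w)) (h : u <+: w) : D u <+: D w := by
  rw [D_eq, D_eq]
  rcases rle_of_prefix hw h with h | ⟨l, t, h1, h2⟩
  · exact drop1Right_prefix_drop1Right (drop1_prefix_drop1 h)
  · rw [h1, h2]
    rcases eq_or_ne l [] with rfl | hl
    · exact List.nil_prefix
    · rw [drop1_append hl, drop1_append hl, drop1Right_append_one, drop1Right_append (by simp)]
      exact List.prefix_append _ _

theorem length_rle_le (w : Word) : (rle w).length ≤ w.length := by
  rw [← sum_rle w]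
  exact List.length_le_sum_of_one_le _ fun n hn => pos_of_mem_rle hn

theorem length_D_lt {w : Word} (hw : w ≠ []) : (D w).length < w.length := by
  have h1 : (D w).length ≤ (drop1 (rle w)).length := by
    rw [D_eq]
    exact (drop1Right_prefix _).length_le
  rcases hr : rle w with _ | ⟨n, t⟩
  · exact absurd (rle_eq_nil.1 hr) hw
  have h2 := length_rle_le w
  rw [hr] at h1 h2
  by_cases hn : n = 1
  · subst hn
    rw [drop1_one_cons] at h1
    simp at h2
    omega
  · rw [drop1_of_head?_ne (by simpa using hn)] at h1
    have h3 : t.length ≤ t.sum :=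
      List.length_le_sum_of_one_le _ fun m hm => pos_of_mem_rle (w := w) (by simp [hr, hm])
    have h4 := sum_rle w
    have h5 : 0 < n := pos_of_mem_rle (w := w) (by simp [hr])
    simp [hr] at h1 h4
    omega

theorem D_nil : D [] = [] := rfl

theorem length_iterate_D_le (w : Word) (k : ℕ) : (D^[k] w).length ≤ w.length - k := by
  induction k with
  | zero => simp
  | succ k ih =>
    rw [Function.iterate_succ_apply']
    rcases eq_or_ne (D^[k] w) [] with h | h
    · simp [h, D_nil]
    · have := length_D_lt h
      omega

theorem iterate_D_eq_nil_of_le {w : Word} {k m : ℕ} (h : D^[k] w = []) (hkm : k ≤ m) :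
    D^[m] w = [] := by
  obtain ⟨d, rfl⟩ := Nat.exists_eq_add_of_le' hkm
  rw [Function.iterate_add_apply, h]
  exact Function.iterate_fixed D_nil d

theorem lt_height_iff {w : Word} {k : ℕ} : k < height w ↔ D^[k] w ≠ [] := by
  refine ⟨fun h => Nat.notMem_of_lt_sInf h, fun h => ?_⟩
  refine Nat.lt_of_succ_le (le_csInf ⟨w.length, ?_⟩ fun m hm => ?_)
  · have := length_iterate_D_le w w.length
    simpa using this
  · by_contra! hlt
    exact h (iterate_D_eq_nil_of_le hm (by omega))

/-! ### C∞-words and avoided run-length prefixes -/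

theorem mem_Cinf_iff_forall {w : Word} : w ∈ Cinf ↔ ∀ j, Diffble (D^[j] w) :=
  ⟨fun h j => (h (j + 1)).2 j (Nat.lt_succ_self j), fun h _ => ⟨(h 0).1, fun j _ => h j⟩⟩

theorem mem_Cinf_iff {w : Word} : w ∈ Cinf ↔ Diffble w ∧ D w ∈ Cinf := by
  simp only [mem_Cinf_iff_forall, ← Function.iterate_succ_apply]
  exact ⟨fun h => ⟨h 0, fun j => h (j + 1)⟩, fun h j => by
    rcases j with _ | j
    exacts [h.1, h.2 j]⟩

theorem Diffble.reverse {w : Word} (h : Diffble w) : Diffble w.reverse :=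
  ⟨isWord_reverse.2 h.1, by rw [rle_reverse]; exact isWord_reverse.2 h.2⟩

theorem iterate_D_reverse (w : Word) (j : ℕ) : D^[j] w.reverse = (D^[j] w).reverse :=
  (Function.Semiconj.iterate_right (f := List.reverse) (ga := D) (gb := D)
    (fun w => (D_reverse w).symm) j w).symm

theorem reverse_mem_Cinf {w : Word} : w.reverse ∈ Cinf ↔ w ∈ Cinf := by
  simp only [mem_Cinf_iff_forall, iterate_D_reverse]
  exact forall_congr' fun j => ⟨fun h => by simpa using h.reverse, Diffble.reverse⟩

/-- No derivative of `w` has a run-length encoding with prefix `a`. -/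
def Avoids (a : List ℕ) (w : Word) : Prop := ∀ j, ¬ a <+: rle (D^[j] w)

theorem avoids_iff {a : List ℕ} {w : Word} : Avoids a w ↔ ¬ a <+: rle w ∧ Avoids a (D w) := by
  simp only [Avoids, ← Function.iterate_succ_apply]
  exact ⟨fun h => ⟨h 0, fun j => h (j + 1)⟩, fun h j => by
    rcases j with _ | j
    exacts [h.1, h.2 j]⟩

theorem avoids_nil {a : List ℕ} (ha : a ≠ []) : Avoids a [] := fun j => by
  rw [Function.iterate_fixed D_nil, rle_nil, List.prefix_nil]
  exact ha

/-- A C∞-word that avoids `a` from both ends. -/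
def BiAvoids (a : List ℕ) (w : Word) : Prop := w ∈ Cinf ∧ Avoids a w ∧ Avoids a w.reverse

theorem biAvoids_iff {a : List ℕ} {w : Word} :
    BiAvoids a w ↔
      Diffble w ∧ ¬ a <+: rle w ∧ ¬ a <+: (rle w).reverse ∧ BiAvoids a (D w) := by
  rw [BiAvoids, mem_Cinf_iff, avoids_iff, avoids_iff (w := w.reverse), rle_reverse, D_reverse,
    BiAvoids]
  tauto

theorem BiAvoids.iterate_D {a : List ℕ} {w : Word} (h : BiAvoids a w) (j : ℕ) :
    BiAvoids a (D^[j] w) := by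
  induction j with
  | zero => exact h
  | succ j ih =>
    rw [Function.iterate_succ_apply']
    exact (biAvoids_iff.1 ih).2.2.2

theorem diffble_nil : Diffble [] := by simp [Diffble, IsWord, rle_nil]

theorem nil_mem_Cinf : [] ∈ Cinf := mem_Cinf_iff_forall.2 fun j => by
  rw [Function.iterate_fixed D_nil]
  exact diffble_nil

theorem biAvoids_nil {a : List ℕ} (ha : a ≠ []) : BiAvoids a [] :=
  ⟨nil_mem_Cinf, avoids_nil ha, avoids_nil ha⟩

theorem biAvoids_singleton {a : List ℕ} (ha : a ≠ []) (ha' : ¬ a <+: [1]) {x : ℕ}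
    (hx : x = 1 ∨ x = 2) : BiAvoids a [x] :=
  biAvoids_iff.2 ⟨by simpa [Diffble, IsWord, rle_singleton] using hx, ha', ha',
    biAvoids_nil ha⟩

theorem Avoids.of_prefix {a : List ℕ} {u w : Word} (hw : w ∈ Cinf) (h : Avoids (a ++ [2]) w)
    (huw : u <+: w) : Avoids (a ++ [2]) u := by
  intro j
  induction j generalizing u w with
  | zero =>
    intro hu
    simp only [Function.iterate_zero, id_eq] at hu
    apply (avoids_iff.1 h).1
    rcases rle_of_prefix (mem_Cinf_iff.1 hw).1.2 huw with h' | ⟨l, t, h1, h2⟩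
    · exact hu.trans h'
    · rw [h1, List.prefix_concat_iff] at hu
      rw [h2]
      rcases hu with hu | hu
      · simp at hu
      · exact hu.trans (List.prefix_append _ _)
  | succ j ih =>
    rw [Function.iterate_succ_apply]
    exact ih (mem_Cinf_iff.1 hw).2 (avoids_iff.1 h).2
      (D_prefix (mem_Cinf_iff.1 hw).1.2 huw)

/-! ### Maximal and minimal words -/

theorem IsPrimitive.reverse {v w : Word} (h : IsPrimitive v w) :
    IsPrimitive v.reverse w.reverse :=
  ⟨h.1.reverse, by rw [D_reverse, h.2]⟩

theorem height_reverse (w : Word) : height w.reverse = height w := by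
  simp [height, iterate_D_reverse]

theorem MaximalWord.reverse {w : Word} (h : MaximalWord w) : MaximalWord w.reverse := by
  refine ⟨reverse_mem_Cinf.2 h.1, by simpa using h.2.1, fun j hj v hv => ?_⟩
  rw [height_reverse] at hj
  rw [iterate_D_reverse] at hv ⊢
  simpa using h.2.2 j hj v.reverse (by simpa using hv.reverse)

theorem MinimalWord.reverse {w : Word} (h : MinimalWord w) : MinimalWord w.reverse := by
  refine ⟨reverse_mem_Cinf.2 h.1, by simpa using h.2.1, fun j hj v hv => ?_⟩
  rw [height_reverse] at hj
  rw [iterate_D_reverse] at hv ⊢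
  simpa using h.2.2 j hj v.reverse (by simpa using hv.reverse)

theorem rightMaximal_iff {w : Word} : RightMaximal w ↔ LeftMaximal w.reverse := by
  constructor
  · rintro ⟨v, hv, h⟩
    exact ⟨v.reverse, hv.reverse, List.reverse_prefix.2 h⟩
  · rintro ⟨v, hv, h⟩
    exact ⟨v.reverse, hv.reverse, List.reverse_prefix.1 (by simpa using h)⟩

theorem rightMinimal_iff {w : Word} : RightMinimal w ↔ LeftMinimal w.reverse := by
  constructor
  · rintro ⟨v, hv, h⟩
    exact ⟨v.reverse, hv.reverse, List.reverse_prefix.2 h⟩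
  · rintro ⟨v, hv, h⟩
    exact ⟨v.reverse, hv.reverse, List.reverse_prefix.1 (by simpa using h)⟩

theorem exists_cons_of_prefix_rle {n : ℕ} {a : List ℕ} {w : Word} (h : n :: a <+: rle w) :
    ∃ x v, w = x :: v := by
  rcases w with _ | ⟨x, v⟩
  · simp [rle_nil] at h
  · exact ⟨x, v, rfl⟩

theorem MaximalWord.avoids {w : Word} (h : MaximalWord w) : Avoids [2] w := by
  intro j hj
  obtain ⟨x, v, hz⟩ := exists_cons_of_prefix_rle hj
  have hd : Diffble (D^[j] w) := mem_Cinf_iff_forall.1 h.1 j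
  obtain ⟨t, ht⟩ := hj
  have hD : D (D^[j] w) = drop1Right (2 :: t) := by
    rw [D_eq, ← ht]
    rfl
  have hne : D (D^[j] w) ≠ [] := by
    rw [hD]
    rcases eq_or_ne t [] with rfl | ht'
    · simp [drop1Right, drop1]
    · simp [drop1Right_cons ht']
  have hx : x = 1 ∨ x = 2 := hd.1 x (by simp [hz])
  have hr : rle (bar x :: D^[j] w) = 1 :: rle (D^[j] w) := by
    rw [hz]
    exact rle_cons_cons_of_ne (bar_ne x) v
  have := h.2.2 j (lt_height_iff.2 (by rwa [Function.iterate_succ_apply'])) (bar x :: D^[j] w)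
    ⟨⟨isWord_cons.2 ⟨bar_eq hx, hd.1⟩, by rw [hr]; exact isWord_cons.2 ⟨.inl rfl, hd.2⟩⟩, by
      rw [Function.iterate_succ_apply', hD, D_eq, hr, drop1_one_cons, ← ht]
      rfl⟩
  simp at this

theorem MinimalWord.avoids {w : Word} (h : MinimalWord w) : Avoids [1, 2] w := by
  intro j hj
  obtain ⟨x, v, hz⟩ := exists_cons_of_prefix_rle hj
  have hd : Diffble (D^[j] w) := mem_Cinf_iff_forall.1 h.1 j
  obtain ⟨t, ht⟩ := hj
  have hD : D (D^[j] w) = drop1Right (2 :: t) := by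
    rw [D_eq, ← ht]
    rfl
  have hne : D (D^[j] w) ≠ [] := by
    rw [hD]
    rcases eq_or_ne t [] with rfl | ht'
    · simp [drop1Right, drop1]
    · simp [drop1Right_cons ht']
  have hr : rle v = 2 :: t := by
    rw [hz] at ht
    rcases rle_cons x v with hv | ⟨n, s, hv, hv'⟩
    · rw [hv] at ht
      simpa using ht.symm
    · rw [hv'] at ht
      have : 0 < n := pos_of_mem_rle (w := v) (by simp [hv])
      simp at ht
      omega
  have := h.2.2 j (lt_height_iff.2 (by rwa [Function.iterate_succ_apply'])) v
    ⟨⟨fun y hy => hd.1 y (by simp [hz, hy]), by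
      rw [hr]
      have := hd.2
      rw [← ht] at this
      exact (isWord_cons.1 this).2⟩, by
      rw [Function.iterate_succ_apply', hD, D_eq, hr]
      rfl⟩
  simp [hz] at this

theorem head?_ne_one_of_not_prefix {p u q : List ℕ} (hu : IsWord u) (hne : u ≠ [])
    (hp : p = [1] ∨ p = [] ∧ u.head? ≠ some 1) (h : ¬ [2] <+: p ++ u ++ q) : p = [1] := by
  rcases hp with rfl | ⟨rfl, hp⟩
  · rfl
  · rcases u with _ | ⟨n, u⟩
    · exact absurd rfl hne
    · have := hu n (by simp)
      simp_all

theorem BiAvoids.maximalWord {w : Word} (h : BiAvoids [2] w) (hne : w ≠ []) :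
    MaximalWord w := by
  refine ⟨h.1, hne, fun j hj v hv => ?_⟩
  have hj := lt_height_iff.1 hj
  rw [Function.iterate_succ_apply'] at hj hv
  obtain ⟨hd, h1, h2, h3⟩ := biAvoids_iff.1 (h.iterate_D j)
  have hu := (mem_Cinf_iff.1 h3.1).1.1
  obtain ⟨p, q, hr, hp, hq⟩ := rle_eq_of_D_ne_nil hj
  rw [hr] at h1 h2
  have hp := head?_ne_one_of_not_prefix hu hj hp h1
  have hq : q.reverse = [1] := by
    refine head?_ne_one_of_not_prefix (isWord_reverse.2 hu) (by simpa using hj) (q := p.reverse)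
      (by simpa using hq) (by simpa using h2)
  rw [List.reverse_eq_iff] at hq
  obtain ⟨p', q', hr', hp', hq'⟩ := rle_eq_of_D_ne_nil (w := v) (by rwa [hv.2])
  rw [← sum_rle, ← sum_rle, hr, hr', hv.2, hp, hq]
  rcases hp' with rfl | ⟨rfl, -⟩ <;> rcases hq' with rfl | ⟨rfl, -⟩ <;> simp; omega

theorem sum_le_of_not_prefix {p p' u q : List ℕ} (hu : IsWord u) (hne : u ≠ [])
    (hp : p = [1] ∨ p = [] ∧ u.head? ≠ some 1) (hp' : p' = [1] ∨ p' = [] ∧ u.head? ≠ some 1)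
    (h : ¬ [1, 2] <+: p ++ u ++ q) : p.sum ≤ p'.sum := by
  rcases hp with rfl | ⟨rfl, hp⟩
  · rcases hp' with rfl | ⟨rfl, hp'⟩
    · rfl
    · rcases u with _ | ⟨n, u⟩
      · exact absurd rfl hne
      · have := hu n (by simp)
        simp_all
  · simp

theorem BiAvoids.minimalWord {w : Word} (h : BiAvoids [1, 2] w) (hne : w ≠ []) :
    MinimalWord w := by
  refine ⟨h.1, hne, fun j hj v hv => ?_⟩
  have hj := lt_height_iff.1 hj
  rw [Function.iterate_succ_apply'] at hj hv
  obtain ⟨hd, h1, h2, h3⟩ := biAvoids_iff.1 (h.iterate_D j)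
  have hu := (mem_Cinf_iff.1 h3.1).1.1
  obtain ⟨p, q, hr, hp, hq⟩ := rle_eq_of_D_ne_nil hj
  obtain ⟨p', q', hr', hp', hq'⟩ := rle_eq_of_D_ne_nil (w := v) (by rwa [hv.2])
  rw [hv.2] at hr' hp' hq'
  rw [hr] at h1 h2
  have hp := sum_le_of_not_prefix hu hj hp hp' h1
  have hq : q.reverse.sum ≤ q'.reverse.sum :=
    sum_le_of_not_prefix (isWord_reverse.2 hu) (by simpa using hj) (q := p.reverse)
      (by simpa using hq) (by simpa using hq') (by simpa using h2)
  rw [← sum_rle, ← sum_rle, hr, hr']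
  simp only [List.sum_append, List.sum_reverse] at hq ⊢
  omega

/-! ### Extending one-sided words to two-sided ones -/

theorem exists_diffble_decode {w : Word} (hw : IsWord w) (hne : w ≠ []) {l q m : List ℕ}
    (hr : rle w = l ++ q) (hq : q = [1] ∨ q = []) (hm : m ≠ []) (hlm : IsWord (l ++ m)) :
    ∃ v, Diffble v ∧ w <+: v ∧ rle v = l ++ m := by
  rcases w with _ | ⟨x, w⟩
  · exact absurd rfl hne
  have hx := (isWord_cons.1 hw).1
  have hpos : ∀ n ∈ l ++ m, 0 < n := fun n hn => by
    have := hlm n hn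
    omega
  refine ⟨decode x (l ++ m), ⟨isWord_decode hx _, by rwa [rle_decode hx hpos]⟩, ?_,
    rle_decode hx hpos⟩
  rw [← decode_rle hw, hr]
  exact decode_prefix hx l hq hm fun n hn => hpos n (by simp [hn])

theorem exists_diffble_lift {w : Word} (hw : Diffble w) {p q q' s : List ℕ}
    (hr : rle w = p ++ D w ++ q) (hu : D w ≠ [])
    (hp : p = [1] ∨ p = [] ∧ (D w).head? ≠ some 1) (hq : q = [1] ∨ q = [])
    (hq' : q' = [1] ∨ q' = [] ∧ (D w ++ s).getLast? ≠ some 1) (hus : IsWord (D w ++ s))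
    (hs : s ++ q' ≠ []) :
    ∃ v, Diffble v ∧ w <+: v ∧ rle v = p ++ (D w ++ s) ++ q' ∧ D v = D w ++ s := by
  have hne : w ≠ [] := by
    rintro rfl
    exact hu rfl
  have hpw : IsWord p := by rcases hp with rfl | ⟨rfl, -⟩ <;> simp [IsWord]
  have hqw : IsWord q' := by rcases hq' with rfl | ⟨rfl, -⟩ <;> simp [IsWord]
  obtain ⟨v, hv, hwv, hrv⟩ := exists_diffble_decode hw.1 hne hr hq hs
    (by rw [isWord_append] at hus; simp only [isWord_append]; tauto)
  have hrv : rle v = p ++ (D w ++ s) ++ q' := by simpa using hrv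
  exact ⟨v, hv, hwv, hrv, D_eq_of_rle_eq (by simp [hu]) hrv
    (by rwa [List.head?_append_of_ne_nil _ hu]) hq'⟩

theorem rle_eq_of_D_eq_nil {w : Word} (hne : w ≠ []) (h : D w = []) :
    rle w = [1] ∨ rle w = [1, 1] := by
  obtain ⟨p, hp, hp'⟩ := exists_drop1 (rle w)
  obtain ⟨q, hq, hq'⟩ := exists_drop1Right (drop1 (rle w))
  rw [← D_eq, h, List.nil_append] at hq
  rw [hq] at hp
  have := rle_eq_nil.not.2 hne
  rcases hp' with rfl | ⟨rfl, -⟩ <;> rcases hq' with rfl | ⟨rfl, -⟩ <;> simp_all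

theorem Avoids.exists_maximalWord {w : Word} (hw : w ∈ Cinf) (hne : w ≠ [])
    (h : Avoids [2] w) : ∃ v, BiAvoids [2] v ∧ w <+: v := by
  obtain ⟨hd, hDw⟩ := mem_Cinf_iff.1 hw
  obtain ⟨h1, hD⟩ := avoids_iff.1 h
  by_cases hu : D w = []
  · refine ⟨w, biAvoids_iff.2 ⟨hd, h1, ?_, hu ▸ biAvoids_nil (List.cons_ne_nil 2 [])⟩,
      List.prefix_rfl⟩
    rcases rle_eq_of_D_eq_nil hne hu with hr | hr <;> simp [hr]
  · have hlt := length_D_lt hne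
    obtain ⟨u', hu', s, rfl⟩ := Avoids.exists_maximalWord hDw hu hD
    obtain ⟨p, q, hr, hp, hq⟩ := rle_eq_of_D_ne_nil hu
    obtain ⟨v, hv, hwv, hrv, hDv⟩ := exists_diffble_lift hd (q' := [1]) hr hu hp
      (hq.imp_right And.left) (.inl rfl) (mem_Cinf_iff.1 hu'.1).1.1 (by simp)
    have hp1 := head?_ne_one_of_not_prefix (mem_Cinf_iff.1 hDw).1.1 hu hp (by rwa [← hr])
    refine ⟨v, biAvoids_iff.2 ⟨hv, ?_, ?_, hDv ▸ hu'⟩, hwv⟩ <;> simp [hrv, hp1]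
termination_by w.length

theorem Avoids.exists_minimalWord {w : Word} (hw : w ∈ Cinf) (hne : w ≠ [])
    (h : Avoids [1, 2] w) : ∃ v, BiAvoids [1, 2] v ∧ w <+: v ∧ w.length < v.length := by
  obtain ⟨hd, hDw⟩ := mem_Cinf_iff.1 hw
  obtain ⟨h1, hD⟩ := avoids_iff.1 h
  by_cases hu : D w = []
  · rcases rle_eq_of_D_eq_nil hne hu with hr | hr
    · obtain ⟨v, hv, hwv, hrv⟩ := exists_diffble_decode hd.1 hne (l := [1]) (q := []) (m := [1])
        hr (.inr rfl) (by simp) (by simp [IsWord])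
      refine ⟨v, biAvoids_iff.2 ⟨hv, by simp [hrv], by simp [hrv], ?_⟩, hwv, ?_⟩
      · rw [D_eq, hrv]
        exact biAvoids_nil (by simp)
      · simp [← sum_rle, hr, hrv]
    · obtain ⟨v, hv, hwv, hrv⟩ := exists_diffble_decode hd.1 hne (l := [1, 1]) (q := [])
        (m := [1]) hr (.inr rfl) (by simp) (by simp [IsWord])
      refine ⟨v, biAvoids_iff.2 ⟨hv, by simp [hrv], by simp [hrv], ?_⟩, hwv, ?_⟩
      · rw [D_eq, hrv]
        exact biAvoids_singleton (by simp) (by simp) (.inl rfl)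
      · simp [← sum_rle, hr, hrv]
  · have hlt := length_D_lt hne
    obtain ⟨u', hu', ⟨s, rfl⟩, hs⟩ := Avoids.exists_minimalWord hDw hu hD
    have hs : s ≠ [] := by
      rintro rfl
      simp at hs
    have hus := (mem_Cinf_iff.1 hu'.1).1.1
    have hsw := (isWord_append.1 hus).2
    obtain ⟨t, c, rfl⟩ := (List.eq_nil_or_concat' s).resolve_left hs
    have hc := hsw c (by simp)
    obtain ⟨p, q, hr, hp, hq⟩ := rle_eq_of_D_ne_nil hu
    obtain ⟨q', hq'⟩ : ∃ q' : List ℕ, c = 1 ∧ q' = [1] ∨ c = 2 ∧ q' = [] := by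
      rcases hc with rfl | rfl
      exacts [⟨[1], by simp⟩, ⟨[], by simp⟩]
    obtain ⟨v, hv, hwv, hrv, hDv⟩ := exists_diffble_lift hd (q' := q') hr hu hp
      (hq.imp_right And.left) (by rcases hq' with ⟨-, rfl⟩ | ⟨rfl, rfl⟩ <;> simp) hus (by simp)
    refine ⟨v, biAvoids_iff.2 ⟨hv, ?_, ?_, hDv ▸ hu'⟩, hwv, ?_⟩
    · rw [hr] at h1
      rw [hrv]
      obtain ⟨n, u, hnu⟩ := List.exists_cons_of_ne_nil hu
      rw [hnu] at h1 hp ⊢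
      rcases hp with rfl | ⟨rfl, hp⟩
      · simp_all
      · have hn : 1 ≠ n := by simpa [eq_comm] using hp
        simp [hn]
    · rcases hq' with ⟨rfl, rfl⟩ | ⟨rfl, rfl⟩ <;> simp [hrv]
    · rw [← sum_rle, ← sum_rle, hr, hrv]
      rcases hq with rfl | ⟨rfl, -⟩ <;> rcases hq' with ⟨rfl, rfl⟩ | ⟨rfl, rfl⟩ <;> simp
termination_by w.length

theorem leftMaximal_iff {w : Word} (hw : w ∈ Cinf) : LeftMaximal w ↔ Avoids [2] w := by
  constructor
  · rintro ⟨v, hv, hwv⟩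
    exact Avoids.of_prefix (a := []) hv.1 hv.avoids hwv
  · intro h
    rcases eq_or_ne w [] with rfl | hne
    · exact ⟨[1], (biAvoids_singleton (by simp) (by simp) (.inl rfl)).maximalWord (by simp),
        List.nil_prefix⟩
    · obtain ⟨v, hv, hwv⟩ := h.exists_maximalWord hw hne
      exact ⟨v, hv.maximalWord (by rintro rfl; exact hne (List.prefix_nil.1 hwv)), hwv⟩

theorem leftMinimal_cons_iff {x : ℕ} {w : Word} (hw : x :: w ∈ Cinf) :
    LeftMinimal (x :: w) ↔ Avoids [1, 2] (x :: w) := by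
  constructor
  · rintro ⟨v, hv, hwv⟩
    exact Avoids.of_prefix (a := [1]) hv.1 hv.avoids hwv
  · intro h
    obtain ⟨v, hv, hwv, -⟩ := h.exists_minimalWord hw (by simp)
    exact ⟨v, hv.minimalWord (by rintro rfl; simp at hwv), hwv⟩

/-! ### Extensions by one letter on the left -/

theorem rle_cons_cases {x y : ℕ} {t : List ℕ} {w : Word} (h : rle (y :: w) = 1 :: t) :
    rle (x :: y :: w) = 1 :: 1 :: t ∨ rle (x :: y :: w) = 2 :: t := by
  rcases rle_cons x (y :: w) with h' | ⟨n, s, h1, h2⟩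
  · exact .inl (by rw [h', h])
  · rw [h] at h1
    obtain ⟨rfl, rfl⟩ := List.cons.inj h1
    exact .inr h2

theorem D_cons_cases {x y : ℕ} {t : List ℕ} {w : Word} (h : rle (y :: w) = 1 :: t)
    (ht : t ≠ []) :
    ∃ z, (z = 1 ∨ z = 2) ∧ D (x :: y :: w) = z :: D (y :: w) := by
  have hD : D (y :: w) = drop1Right t := by rw [D_eq, h, drop1_one_cons]
  rcases rle_cons_cases (x := x) h with h' | h'
  · exact ⟨1, .inl rfl, by rw [hD, D_eq, h', drop1_one_cons, drop1Right_cons ht]⟩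
  · refine ⟨2, .inr rfl, ?_⟩
    rw [hD, D_eq, h', ← drop1Right_cons ht]
    rfl

theorem avoids_of_avoids_cons {x : ℕ} {w : Word} (hxw : x :: w ∈ Cinf)
    (h : Avoids [1, 2] (x :: w)) : Avoids [2] w := by
  induction hlen : w.length using Nat.strong_induction_on generalizing x w with | _ n ih
  subst hlen
  rcases w with _ | ⟨y, w⟩
  · exact avoids_nil (by simp)
  obtain ⟨hd, hDc⟩ := mem_Cinf_iff.1 hxw
  obtain ⟨h1, hDa⟩ := avoids_iff.1 h
  have hpre : ¬ [2] <+: rle (y :: w) := by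
    rintro ⟨t, ht⟩
    rcases rle_cons x (y :: w) with h' | ⟨n, s, h2, h3⟩
    · exact h1 ⟨t, by rw [h', ← ht]; rfl⟩
    · obtain ⟨rfl, rfl⟩ := List.cons.inj (ht.trans h2)
      have := hd.2 3 (by simp [h3])
      omega
  refine avoids_iff.2 ⟨hpre, ?_⟩
  rcases hr : rle (y :: w) with _ | ⟨n, t⟩
  · simp [rle_eq_nil] at hr
  have hn : n = 1 := by
    have hd' : IsWord (rle (x :: y :: w)) := hd.2
    have hpos : 0 < n := pos_of_mem_rle (w := y :: w) (by simp [hr])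
    have : n ≠ 2 := by
      rintro rfl
      exact hpre (by simp [hr])
    rcases rle_cons x (y :: w) with h' | ⟨m, s, h2, h3⟩
    · have := hd' n (by simp [h', hr])
      omega
    · obtain ⟨rfl, rfl⟩ := List.cons.inj (hr.symm.trans h2)
      have := hd' (n + 1) (by simp [h3])
      omega
  subst hn
  rcases eq_or_ne t [] with rfl | ht
  · rw [D_eq, hr]
    exact avoids_nil (by simp)
  · have hlt := length_D_lt (List.cons_ne_nil y w)
    obtain ⟨z, -, hz⟩ := D_cons_cases (x := x) hr ht
    rw [hz] at hDc hDa
    exact ih _ hlt hDc hDa rfl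

theorem Avoids.cons {x : ℕ} {w : Word} (hx : x = 1 ∨ x = 2) (hw : w ∈ Cinf)
    (h : Avoids [2] w) : x :: w ∈ Cinf ∧ Avoids [1, 2] (x :: w) := by
  have key {z : ℕ} (hz : z = 1 ∨ z = 2) : [z] ∈ Cinf ∧ Avoids [1, 2] [z] :=
    have := biAvoids_singleton (a := [1, 2]) (by simp) (by simp) hz
    ⟨this.1, this.2.1⟩
  induction hlen : w.length using Nat.strong_induction_on generalizing x w with | _ n ih
  subst hlen
  rcases w with _ | ⟨y, w⟩
  · exact key hx
  obtain ⟨hd, hDc⟩ := mem_Cinf_iff.1 hw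
  obtain ⟨h1, hDa⟩ := avoids_iff.1 h
  obtain ⟨t, ht⟩ : ∃ t, rle (y :: w) = 1 :: t := by
    rcases hr : rle (y :: w) with _ | ⟨n, t⟩
    · simp [rle_eq_nil] at hr
    · rcases hd.2 n (by simp [hr]) with rfl | rfl
      · exact ⟨t, rfl⟩
      · simp [hr] at h1
  have hrle := rle_cons_cases (x := x) ht
  have htw : IsWord t := (isWord_cons.1 (ht ▸ hd.2)).2
  have hd' : Diffble (x :: y :: w) := by
    refine ⟨isWord_cons.2 ⟨hx, hd.1⟩, ?_⟩
    rcases hrle with h' | h' <;> simp [h', isWord_cons, htw]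
  have h1' : ¬ [1, 2] <+: rle (x :: y :: w) := by
    rcases hrle with h' | h' <;> simp [h']
  rw [mem_Cinf_iff, avoids_iff]
  suffices D (x :: y :: w) ∈ Cinf ∧ Avoids [1, 2] (D (x :: y :: w)) from
    ⟨⟨hd', this.1⟩, h1', this.2⟩
  rcases eq_or_ne t [] with rfl | ht'
  · rcases hrle with h' | h' <;> rw [D_eq, h']
    · exact ⟨nil_mem_Cinf, avoids_nil (by simp)⟩
    · exact key (.inr rfl)
  · have hlt := length_D_lt (List.cons_ne_nil y w)
    obtain ⟨z, hz, hD⟩ := D_cons_cases (x := x) ht ht'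
    rw [hD]
    exact ih _ hlt hz hDc hDa rfl

theorem leftMaximal_of_leftMinimal_cons {x : ℕ} {w : Word} (hw : w ∈ Cinf)
    (hxw : x :: w ∈ Cinf) (h : LeftMinimal (x :: w)) : LeftMaximal w :=
  (leftMaximal_iff hw).2 (avoids_of_avoids_cons hxw ((leftMinimal_cons_iff hxw).1 h))

theorem LeftMaximal.cons {x : ℕ} {w : Word} (hw : w ∈ Cinf) (h : LeftMaximal w)
    (hx : x = 1 ∨ x = 2) : x :: w ∈ Cinf ∧ LeftMinimal (x :: w) := by
  obtain ⟨h1, h2⟩ := ((leftMaximal_iff hw).1 h).cons hx hw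
  exact ⟨h1, (leftMinimal_cons_iff h1).2 h2⟩

theorem leftMaximal_iff_extension_leftMinimal {w : Word} (hw : w ∈ Cinf) :
    (LeftMaximal w ↔ ∃ x, (x = 1 ∨ x = 2) ∧ x :: w ∈ Cinf ∧ LeftMinimal (x :: w)) ∧
      ∀ x, (x = 1 ∨ x = 2) → (x :: w ∈ Cinf ∧ LeftMinimal (x :: w)) →
        (bar x :: w ∈ Cinf ∧ LeftMinimal (bar x :: w)) :=
  ⟨⟨fun h => ⟨1, .inl rfl, h.cons hw (.inl rfl)⟩,
    fun ⟨_, _, hxw, h⟩ => leftMaximal_of_leftMinimal_cons hw hxw h⟩,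
    fun _ hx h => (leftMaximal_of_leftMinimal_cons hw h.1 h.2).cons hw (bar_eq hx)⟩

end CinftyWords

open CinftyWords in
/-- A C∞-word `w` is right maximal iff `wx` is a right minimal C∞-word for some letter
`x`; moreover if `wx` is a right minimal C∞-word then so is `w x̄`. Symmetrically for
left maximal / left minimal with extensions on the left. -/
theorem right_maximal_iff_extension_right_minimal (w : Word) (hw : w ∈ Cinf) :
    ((RightMaximal w ↔ ∃ x, (x = 1 ∨ x = 2) ∧ w ++ [x] ∈ Cinf ∧ RightMinimal (w ++ [x])) ∧
     (∀ x, (x = 1 ∨ x = 2) → (w ++ [x] ∈ Cinf ∧ RightMinimal (w ++ [x])) →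
        (w ++ [bar x] ∈ Cinf ∧ RightMinimal (w ++ [bar x])))) ∧
    ((LeftMaximal w ↔ ∃ x, (x = 1 ∨ x = 2) ∧ x :: w ∈ Cinf ∧ LeftMinimal (x :: w)) ∧
     (∀ x, (x = 1 ∨ x = 2) → (x :: w ∈ Cinf ∧ LeftMinimal (x :: w)) →
        (bar x :: w ∈ Cinf ∧ LeftMinimal (bar x :: w)))) := by
  refine ⟨?_, leftMaximal_iff_extension_leftMinimal hw⟩
  have hmem (x : ℕ) : w ++ [x] ∈ Cinf ↔ x :: w.reverse ∈ Cinf := by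
    rw [← reverse_mem_Cinf]
    simp
  have hmin (x : ℕ) : RightMinimal (w ++ [x]) ↔ LeftMinimal (x :: w.reverse) := by
    rw [rightMinimal_iff]
    simp
  simp only [hmem, hmin, rightMaximal_iff]
  exact leftMaximal_iff_extension_leftMinimal (reverse_mem_Cinf.2 hw)
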